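/- Let δ₁, δ₂ ∈ [0, π/2] and θ₁, θ₂ ∈ ℝ. Define the points p_i = (sin δ_i · cos θ_i, sin δ_i · sin θ_i, cos δ_i) ∈ ℝ³ on the upper unit hemisphere, and their images p'_i = (δ_i · cos θ_i, δ_i · sin θ_i) ∈ ℝ² under the mapping M. Then ‖p₁ − p₂‖₂ ≤ ‖p'₁ − p'₂‖₂, where each norm is the Euclidean norm on the respective space. -/

import Mathlib

/-- The point of `ℝ³` (with the Euclidean norm) with coordinates `(a, b, c)`. -/
noncomputable def pt3 (a b c : ℝ) : EuclideanSpace ℝ (Fin 3) := (WithLp.equiv 2 (Fin 3 → ℝ)).symm ![a, b, c]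

/-- The point of `ℝ²` (with the Euclidean norm) with coordinates `(a, b)`. -/
noncomputable def pt2 (a b : ℝ) : EuclideanSpace ℝ (Fin 2) := (WithLp.equiv 2 (Fin 2 → ℝ)).symm ![a, b]

open Real in
/-- the mapping `M` sending the point of the upper unit hemisphere with
polar angle `δ` and azimuth `θ` to the planar point with polar coordinates `(δ, θ)` does
not decrease Euclidean distances. -/
theorem hemisphere_mapping_expands (δ₁ δ₂ θ₁ θ₂ : ℝ)
    (h₁ : δ₁ ∈ Set.Icc 0 (π/2)) (h₂ : δ₂ ∈ Set.Icc 0 (π/2)) :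
    ‖pt3 (sin δ₁ * cos θ₁) (sin δ₁ * sin θ₁) (cos δ₁) -
        pt3 (sin δ₂ * cos θ₂) (sin δ₂ * sin θ₂) (cos δ₂)‖ ≤
      ‖pt2 (δ₁ * cos θ₁) (δ₁ * sin θ₁) - pt2 (δ₂ * cos θ₂) (δ₂ * sin θ₂)‖ := by
  have hsin₁ := sin_le h₁.1
  have hsin₂ := sin_le h₂.1
  have hprod : 0 ≤ δ₁ * δ₂ - sin δ₁ * sin δ₂ :=
    sub_nonneg.2 (mul_le_mul hsin₁ hsin₂
      (sin_nonneg_of_nonneg_of_le_pi h₂.1 (by linarith [h₂.2, pi_pos])) h₁.1)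
  have hazimuth : 0 ≤ 1 - cos (θ₁ - θ₂) := sub_nonneg.2 (cos_le_one _)
  have hmul := mul_nonneg hazimuth hprod
  have hpolar := one_sub_sq_div_two_le_cos (x := δ₁ - δ₂)
  rw [cos_sub] at hmul hpolar
  rw [EuclideanSpace.norm_eq, EuclideanSpace.norm_eq]
  apply sqrt_le_sqrt
  simp only [pt3, pt2, Fin.sum_univ_three, Fin.sum_univ_two, norm_eq_abs, sq_abs,
    PiLp.sub_apply, WithLp.equiv_symm_apply, Matrix.cons_val]
  have hδ₁ := sin_sq_add_cos_sq δ₁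
  have hδ₂ := sin_sq_add_cos_sq δ₂
  have hθ₁ := sin_sq_add_cos_sq θ₁
  have hθ₂ := sin_sq_add_cos_sq θ₂
  linear_combination 2 * hpolar + 2 * hmul + hδ₁ + hδ₂ +
    (sin δ₁ ^ 2 - δ₁ ^ 2) * hθ₁ + (sin δ₂ ^ 2 - δ₂ ^ 2) * hθ₂
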